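/- arXiv:2406.03674 — 3 statements merged into one kernel-verified Lean document; each statement's English description precedes it below -/
import Mathlib

section
/- For every m ∈ ℕ and every m-uniform bidding strategy b = ⟨(b_1,q_1),…,(b_m,q_m)⟩, b is safe if and only if b_ℓ ≤ w_{Q_ℓ} for every ℓ ∈ {1,…,m}. Equivalently, the class of m-uniform safe strategies is exactly { ⟨(b_1,q_1),…,(b_m,q_m)⟩ m-uniform : b_ℓ ≤ w_{Q_ℓ} for all ℓ ∈ {1,…,m} }. -/
open Finset

namespace Auction

/-- A competing-bid profile for an auction of `K` identical units, represented by the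
function sending `j ∈ {1,…,K}` to the `j`-th smallest element of the multiset of the
`K` largest competing bids. -/
structure Profile (K : ℕ) where
  c : ℕ → ℝ
  mono : ∀ i j : ℕ, 1 ≤ i → i ≤ j → j ≤ K → c i ≤ c j
  nonneg : ∀ j : ℕ, 1 ≤ j → j ≤ K → 0 ≤ c j

/-- A bid vector: `n` units are demanded and `bid j` is the bid for the `j`-th unit
(for `1 ≤ j ≤ n`). -/
structure BidVec where
  n : ℕ
  bid : ℕ → ℝ

/-- A bid vector is valid if its bids are non-increasing and positive. -/
def BidVec.Valid (b : BidVec) : Prop :=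
  (∀ i j : ℕ, 1 ≤ i → i ≤ j → j ≤ b.n → b.bid j ≤ b.bid i) ∧
  ∀ j : ℕ, 1 ≤ j → j ≤ b.n → 0 < b.bid j

open Classical in
/-- The number of units the bidder wins (ties broken in the bidder's favor): the
largest `r ≤ min n K` such that the bidder's `j`-th bid is at least the `j`-th
threshold `β.c j` for every `j ≤ r`. -/
noncomputable def alloc (K : ℕ) (b : BidVec) (β : Profile K) : ℕ :=
  ((Finset.Icc 1 (min b.n K)).filter fun r => ∀ j ∈ Finset.Icc 1 r, β.c j ≤ b.bid j).sup id

/-- The clearing price: the `K`-th highest among all submitted bids (taken to be `0`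
when the bidder wins no unit). -/
noncomputable def price (K : ℕ) (b : BidVec) (β : Profile K) : ℝ :=
  if alloc K b β = 0 then 0
  else if alloc K b β < K then min (b.bid (alloc K b β)) (β.c (alloc K b β + 1))
  else b.bid K

/-- The value obtained by the bidder. -/
noncomputable def value (v : ℕ → ℝ) (K : ℕ) (b : BidVec) (β : Profile K) : ℝ :=
  ∑ j ∈ Finset.Icc 1 (alloc K b β), v j

/-- The bidder's total payment. -/
noncomputable def payment (K : ℕ) (b : BidVec) (β : Profile K) : ℝ :=
  price K b β * (alloc K b β : ℝ)

/-- The RoI constraint (with target RoI `γ = 0`) against a single competing-bid profile. -/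
def Feasible (v : ℕ → ℝ) (K : ℕ) (b : BidVec) (β : Profile K) : Prop :=
  payment K b β ≤ value v K b β

/-- A bid vector is safe if it satisfies the RoI constraint against every profile. -/
def Safe (v : ℕ → ℝ) (K : ℕ) (b : BidVec) : Prop :=
  ∀ β : Profile K, Feasible v K b β

/-- A valuation vector: nonnegative and non-increasing on `{1,…,M}`. -/
def ValidValuation (M : ℕ) (v : ℕ → ℝ) : Prop :=
  (∀ j : ℕ, 1 ≤ j → j ≤ M → 0 ≤ v j) ∧
  ∀ i j : ℕ, 1 ≤ i → i ≤ j → j ≤ M → v j ≤ v i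

/-- The average cumulative valuation `w_j = (v_1 + ⋯ + v_j) / j`. -/
noncomputable def w (v : ℕ → ℝ) (j : ℕ) : ℝ :=
  (∑ ℓ ∈ Finset.Icc 1 j, v ℓ) / (j : ℝ)

/-- An `m`-uniform bidding strategy: bid-quantity pairs `(b j, q j)` for `1 ≤ j ≤ m`. -/
structure Uniform where
  m : ℕ
  b : ℕ → ℝ
  q : ℕ → ℕ

/-- Cumulative quantities `Q j = q 1 + ⋯ + q j`. -/
def Uniform.Q (s : Uniform) (j : ℕ) : ℕ := ∑ ℓ ∈ Finset.Icc 1 j, s.q ℓ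

/-- `s` is a genuine `m`-uniform strategy for maximum demand `M`:
`b 1 > b 2 > ⋯ > b m > 0`, positive quantities, and `Q m ≤ M`. -/
def Uniform.IsUniform (M : ℕ) (s : Uniform) : Prop :=
  1 ≤ s.m ∧
  (∀ j : ℕ, 1 ≤ j → j ≤ s.m → 0 < s.q j) ∧
  0 < s.b s.m ∧
  (∀ j : ℕ, 1 ≤ j → j < s.m → s.b (j + 1) < s.b j) ∧
  s.Q s.m ≤ M

/-- The bid vector associated to a uniform strategy: the bid on the `j`-th unit is
`b ℓ`, where `ℓ` is least with `j ≤ Q ℓ`. -/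
noncomputable def Uniform.toBidVec (s : Uniform) : BidVec :=
  ⟨s.Q s.m, fun j => s.b (sInf {ℓ : ℕ | j ≤ s.Q ℓ})⟩

/-- The 1-uniform strategy bidding `b` on `q` units. -/
def single (b : ℝ) (q : ℕ) : Uniform := ⟨1, fun _ => b, fun _ => q⟩

/-- Membership in the class `𝒫*_{≤ m}` of safe undominated strategies with at most `m`
bid-quantity pairs: strategies determined by a tuple `0 < Q 1 < ⋯ < Q k ≤ M` (`k ≤ m`)
via `b ℓ = w (Q ℓ)` and `q ℓ = Q ℓ - Q (ℓ-1)`. -/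
def InSafeClass (M : ℕ) (v : ℕ → ℝ) (m : ℕ) (s : Uniform) : Prop :=
  1 ≤ s.m ∧ s.m ≤ m ∧ (∀ j : ℕ, 1 ≤ j → j ≤ s.m → 0 < s.q j) ∧ s.Q s.m ≤ M ∧
  ∀ ℓ : ℕ, 1 ≤ ℓ → ℓ ≤ s.m → s.b ℓ = w v (s.Q ℓ)

/-- Membership in the class `𝒬_{≤ m}(H)` of strategies with at most `m` bid-quantity
pairs that are RoI-feasible for the bid history `H` over rounds `1,…,T`. -/
def InFeasClass (M : ℕ) (v : ℕ → ℝ) (K T : ℕ) (H : ℕ → Profile K) (m : ℕ) (s : Uniform) : Prop :=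
  s.IsUniform M ∧ s.m ≤ m ∧ ∀ t ∈ Finset.Icc 1 T, Feasible v K s.toBidVec (H t)

/-- Total value obtained by strategy `s` over the bid history `H` on rounds `1,…,T`. -/
noncomputable def totalValue (v : ℕ → ℝ) (K T : ℕ) (H : ℕ → Profile K) (s : Uniform) : ℝ :=
  ∑ t ∈ Finset.Icc 1 T, value v K s.toBidVec (H t)

/-- The optimal total value over the class `𝒫*_{≤ m}`. -/
noncomputable def bestSafe (M : ℕ) (v : ℕ → ℝ) (K T : ℕ) (H : ℕ → Profile K) (m : ℕ) : ℝ :=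
  sSup {x : ℝ | ∃ s : Uniform, InSafeClass M v m s ∧ x = totalValue v K T H s}

/-- The optimal total value over the class `𝒬_{≤ m}(H)`. -/
noncomputable def bestFeas (M : ℕ) (v : ℕ → ℝ) (K T : ℕ) (H : ℕ → Profile K) (m : ℕ) : ℝ :=
  sSup {x : ℝ | ∃ s : Uniform, InFeasClass M v K T H m s ∧ x = totalValue v K T H s}

/-- Average cumulative valuations are non-increasing. -/
theorem w_antitone {M : ℕ} {v : ℕ → ℝ} (hv : ValidValuation M v) {r n : ℕ}
    (hr : 1 ≤ r) (hrn : r ≤ n) (hn : n ≤ M) : w v n ≤ w v r := by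
  induction n, hrn using Nat.le_induction with
  | base => exact le_rfl
  | succ n hrn ih =>
    refine le_trans ?_ (ih (by omega))
    have hpos : (0 : ℝ) < n := by exact_mod_cast (by omega : 0 < n)
    have h : (n : ℝ) * v (n + 1) ≤ ∑ ℓ ∈ Icc 1 n, v ℓ := by
      have := card_nsmul_le_sum (Icc 1 n) v (v (n + 1)) fun i hi => by
        rw [mem_Icc] at hi
        exact hv.2 i (n + 1) hi.1 (by omega) hn
      simpa using this
    unfold w
    rw [sum_Icc_succ_top (by omega), div_le_div_iff₀ (by positivity) hpos]
    push_cast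
    nlinarith

theorem sum_eq_w_mul (v : ℕ → ℝ) {r : ℕ} (hr : r ≠ 0) :
    ∑ ℓ ∈ Icc 1 r, v ℓ = w v r * r := by
  have : (r : ℝ) ≠ 0 := by exact_mod_cast hr
  rw [w, div_mul_cancel₀ _ this]

theorem alloc_le (K : ℕ) (b : BidVec) (β : Profile K) : alloc K b β ≤ min b.n K := by
  classical
  refine Finset.sup_le fun r hr => ?_
  simp only [mem_filter, mem_Icc] at hr
  exact hr.1.2

/-- The clearing price never exceeds the lowest winning bid. -/
theorem price_le_bid_alloc {K : ℕ} {b : BidVec} {β : Profile K} (h : alloc K b β ≠ 0) :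
    price K b β ≤ b.bid (alloc K b β) := by
  unfold price
  rw [if_neg h]
  split_ifs with hK
  · exact min_le_left _ _
  · have := alloc_le K b β
    rw [show alloc K b β = K by omega]

/-- The allocation is `r` if the first `r` bids clear their thresholds and no later bid does. -/
theorem alloc_eq {K : ℕ} {b : BidVec} {β : Profile K} {r : ℕ} (hr : 1 ≤ r) (hn : r ≤ b.n)
    (hK : r ≤ K) (hwin : ∀ j, 1 ≤ j → j ≤ r → β.c j ≤ b.bid j)
    (hlose : ∀ j, r < j → j ≤ b.n → b.bid j < β.c j) : alloc K b β = r := by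
  classical
  apply le_antisymm
  · refine Finset.sup_le fun t ht => ?_
    simp only [mem_filter, mem_Icc] at ht
    by_contra! hlt
    have hlt : r < t := hlt
    exact absurd (ht.2 t ⟨ht.1.1, le_rfl⟩) (not_le.2 (hlose t hlt (by omega)))
  · refine Finset.le_sup (f := id) (?_ : r ∈ _)
    simp only [mem_filter, mem_Icc]
    exact ⟨⟨hr, le_min hn hK⟩, fun j hj => hwin j hj.1 hj.2⟩

/-- The competing-bid profile all of whose `K` bids equal `x`. -/
def Profile.const (K : ℕ) (x : ℝ) (hx : 0 ≤ x) : Profile K :=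
  ⟨fun _ => x, fun _ _ _ _ _ => le_rfl, fun _ _ _ => hx⟩

theorem Uniform.Q_mono (s : Uniform) : Monotone s.Q := fun _ _ h =>
  sum_le_sum_of_subset (Icc_subset_Icc_right h)

@[simp]
theorem Uniform.Q_zero (s : Uniform) : s.Q 0 = 0 := by simp [Uniform.Q]

namespace Uniform.IsUniform

variable {M : ℕ} {s : Uniform}

theorem Q_lt (hs : s.IsUniform M) {i j : ℕ} (hij : i < j) (hj : j ≤ s.m) : s.Q i < s.Q j := by
  have h1 : s.Q (i + 1) = s.Q i + s.q (i + 1) := sum_Icc_succ_top (by omega) _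
  have h2 := hs.2.1 (i + 1) (by omega) (by omega)
  have h3 := s.Q_mono (show i + 1 ≤ j from hij)
  omega

theorem b_lt (hs : s.IsUniform M) {i j : ℕ} (hi : 1 ≤ i) (hij : i < j) (hj : j ≤ s.m) :
    s.b j < s.b i := by
  induction j, (show i + 1 ≤ j from hij) using Nat.le_induction with
  | base => exact hs.2.2.2.1 i hi (by omega)
  | succ n hn ih =>
    exact (hs.2.2.2.1 n (by omega) (by omega)).trans (ih (by omega) (by omega))

theorem b_le (hs : s.IsUniform M) {i j : ℕ} (hi : 1 ≤ i) (hij : i ≤ j) (hj : j ≤ s.m) :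
    s.b j ≤ s.b i := by
  rcases hij.eq_or_lt with rfl | h
  · exact le_rfl
  · exact (hs.b_lt hi h hj).le

theorem b_pos (hs : s.IsUniform M) {i : ℕ} (hi : 1 ≤ i) (him : i ≤ s.m) : 0 < s.b i :=
  hs.2.2.1.trans_le (hs.b_le hi him le_rfl)

end Uniform.IsUniform

/-- The bid on a demanded unit `j` is `s.b k` for the index `k` of the block containing `j`. -/
theorem Uniform.exists_bid_eq (s : Uniform) {j : ℕ} (hj : 1 ≤ j) (hjm : j ≤ s.Q s.m) :
    ∃ k, 1 ≤ k ∧ k ≤ s.m ∧ j ≤ s.Q k ∧ s.toBidVec.bid j = s.b k ∧ ∀ ℓ, j ≤ s.Q ℓ → k ≤ ℓ := by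
  have hmem : j ≤ s.Q (sInf {ℓ : ℕ | j ≤ s.Q ℓ}) := Nat.sInf_mem (s := {ℓ | j ≤ s.Q ℓ}) ⟨_, hjm⟩
  have hmin : ∀ ℓ, j ≤ s.Q ℓ → sInf {ℓ : ℕ | j ≤ s.Q ℓ} ≤ ℓ := fun ℓ h => Nat.sInf_le h
  refine ⟨_, Nat.one_le_iff_ne_zero.2 fun h => ?_, hmin _ hjm, hmem, rfl, hmin⟩
  rw [h, Q_zero] at hmem
  omega

/-- Against competing bids all equal to `s.b ℓ`, the bidder wins `Q ℓ` units at price `s.b ℓ`. -/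
theorem Uniform.IsUniform.alloc_price_const {K M : ℕ} {s : Uniform} (hs : s.IsUniform M)
    (hMK : M ≤ K) {ℓ : ℕ} (hℓ : 1 ≤ ℓ) (hℓm : ℓ ≤ s.m) :
    alloc K s.toBidVec (.const K (s.b ℓ) (hs.b_pos hℓ hℓm).le) = s.Q ℓ ∧
    price K s.toBidVec (.const K (s.b ℓ) (hs.b_pos hℓ hℓm).le) = s.b ℓ := by
  have hpos : 0 < s.Q ℓ := by simpa using hs.Q_lt (i := 0) hℓ hℓm
  have hQm : s.Q ℓ ≤ s.Q s.m := s.Q_mono hℓm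
  have hQK : s.Q ℓ ≤ K := hQm.trans (hs.2.2.2.2.trans hMK)
  have hal : alloc K s.toBidVec (.const K (s.b ℓ) (hs.b_pos hℓ hℓm).le) = s.Q ℓ := by
    refine alloc_eq hpos hQm hQK (fun j hj hjℓ => ?_) fun j hj hjm => ?_
    · obtain ⟨k, hk, -, -, hbid, hmin⟩ := s.exists_bid_eq hj (hjℓ.trans hQm)
      rw [hbid]
      exact hs.b_le hk (hmin ℓ hjℓ) hℓm
    · obtain ⟨k, -, hkm, hjk, hbid, -⟩ := s.exists_bid_eq (by omega) hjm
      rw [hbid]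
      exact hs.b_lt hℓ (s.Q_mono.reflect_lt (hj.trans_le hjk)) hkm
  have hbid : s.toBidVec.bid (s.Q ℓ) = s.b ℓ := by
    obtain ⟨k, -, -, hk, hbid, hmin⟩ := s.exists_bid_eq hpos hQm
    rcases (hmin ℓ le_rfl).eq_or_lt with rfl | h
    · exact hbid
    · exact absurd (hs.Q_lt h hℓm) (not_lt.2 hk)
  refine ⟨hal, ?_⟩
  unfold price
  rw [hal, if_neg hpos.ne', hbid]
  split_ifs with h
  · exact min_self _
  · rw [← hbid, show K = s.Q ℓ by omega]

/-- Theorem `thm:P-m`: an `m`-uniform bidding strategy is safe if and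
only if it never overbids, i.e. `b ℓ ≤ w (Q ℓ)` for every `ℓ ∈ {1,…,m}`. -/
theorem safe_iff_no_overbid
    (K M : ℕ) (v : ℕ → ℝ) (hv : ValidValuation M v) (hMK : M ≤ K)
    (s : Uniform) (hs : s.IsUniform M) :
    Safe v K s.toBidVec ↔ ∀ ℓ : ℕ, 1 ≤ ℓ → ℓ ≤ s.m → s.b ℓ ≤ w v (s.Q ℓ) := by
  constructor
  · intro h ℓ hℓ hℓm
    have hf := h (.const K (s.b ℓ) (hs.b_pos hℓ hℓm).le)
    obtain ⟨hal, hpr⟩ := hs.alloc_price_const hMK hℓ hℓm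
    have hpos : 0 < s.Q ℓ := by simpa using hs.Q_lt (i := 0) hℓ hℓm
    rw [Feasible, payment, value, hal, hpr] at hf
    rw [w, le_div_iff₀ (by exact_mod_cast hpos)]
    exact hf
  · intro h β
    rw [Feasible, payment, value]
    by_cases h0 : alloc K s.toBidVec β = 0
    · simp [h0]
    have hal : alloc K s.toBidVec β ≤ s.Q s.m := (alloc_le K s.toBidVec β).trans (min_le_left _ _)
    obtain ⟨k, hk, hkm, hjk, hbid, -⟩ := s.exists_bid_eq (Nat.one_le_iff_ne_zero.2 h0) hal
    rw [sum_eq_w_mul v h0]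
    refine mul_le_mul_of_nonneg_right ?_ (Nat.cast_nonneg _)
    calc price K s.toBidVec β ≤ s.b k := hbid ▸ price_le_bid_alloc h0
      _ ≤ w v (s.Q k) := h k hk hkm
      _ ≤ _ := w_antitone hv (Nat.one_le_iff_ne_zero.2 h0) hjk
        ((s.Q_mono hkm).trans hs.2.2.2.2)

end Auction
end

section
/- Monotonicity of feasible bids: let k ≤ M and let b = (b_1,…,b_k) and b' = (b'_1,…,b'_k) be non-increasing bid vectors with b_j ≥ b'_j for every j ∈ {1,…,k}. If b satisfies the RoI constraint against a competing-bid profile β₋ (i.e., V(b;β₋) ≥ P(b;β₋)), then b' also satisfies the RoI constraint against β₋, and V(b;β₋) ≥ V(b';β₋). -/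
open Finset

namespace Auction

theorem threshold_le_bid (K : ℕ) (b : BidVec) (β : Profile K) {j : ℕ} (hj : 1 ≤ j)
    (hja : j ≤ alloc K b β) : β.c j ≤ b.bid j := by
  classical
  unfold alloc at hja
  obtain ⟨r, hr, hjr⟩ := (Finset.le_sup_iff (show (⊥ : ℕ) < j from hj)).1 hja
  simp only [Finset.mem_filter, Finset.mem_Icc] at hr
  exact hr.2 j ⟨hj, hjr⟩

theorem alloc_mono {K : ℕ} {b b' : BidVec} (hn : b'.n = b.n)
    (hle : ∀ j : ℕ, 1 ≤ j → j ≤ b.n → b'.bid j ≤ b.bid j) (β : Profile K) :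
    alloc K b' β ≤ alloc K b β := by
  classical
  unfold alloc
  refine Finset.sup_mono fun r hr => ?_
  simp only [Finset.mem_filter, Finset.mem_Icc, hn] at hr ⊢
  refine ⟨hr.1, fun j hj => (hr.2 j hj).trans (hle j hj.1 ?_)⟩
  have := hr.1.2
  omega

theorem threshold_le_price {K : ℕ} (b : BidVec) (β : Profile K) (h : alloc K b β ≠ 0) :
    β.c (alloc K b β) ≤ price K b β := by
  have hK := alloc_le K b β
  have hbid := threshold_le_bid K b β (Nat.one_le_iff_ne_zero.2 h) le_rfl
  unfold price
  rw [if_neg h]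
  split_ifs with hlt
  · exact le_min hbid (β.mono _ _ (by omega) (by omega) (by omega))
  · have heq : alloc K b β = K := by omega
    rwa [heq] at hbid ⊢

theorem price_mono {K : ℕ} {b b' : BidVec} (hn : b'.n = b.n)
    (hle : ∀ j : ℕ, 1 ≤ j → j ≤ b.n → b'.bid j ≤ b.bid j) (β : Profile K)
    (h : alloc K b' β ≠ 0) : price K b' β ≤ price K b β := by
  have hK := alloc_le K b β
  rcases (alloc_mono hn hle β).eq_or_lt with heq | hlt
  · unfold price
    rw [heq] at h ⊢
    rw [if_neg h, if_neg h]
    split_ifs with hlt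
    · exact min_le_min_right _ (hle _ (by omega) (by omega))
    · exact hle _ (by omega) (by omega)
  · refine le_trans ?_ (threshold_le_price b β (by omega))
    unfold price
    rw [if_neg h, if_pos (by omega)]
    exact (min_le_right _ _).trans (β.mono _ _ (by omega) (by omega) (by omega))

/-- For a non-increasing sequence, a lower bound `p` on the average of the first
`x` terms is a bound on the average of the first `y ≤ x` terms. -/
theorem mul_le_sum_of_mul_le_sum {v : ℕ → ℝ} {x y : ℕ} {p : ℝ}
    (hv : ∀ i j : ℕ, 1 ≤ i → i ≤ j → j ≤ x → v j ≤ v i) (hyx : y ≤ x)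
    (h : p * x ≤ ∑ j ∈ Finset.Icc 1 x, v j) : p * y ≤ ∑ j ∈ Finset.Icc 1 y, v j := by
  by_cases hp : ∀ j ∈ Finset.Icc 1 y, p ≤ v j
  · simpa [mul_comm] using Finset.card_nsmul_le_sum (Finset.Icc 1 y) v p hp
  · push Not at hp
    obtain ⟨i, hi, hip⟩ := hp
    rw [Finset.mem_Icc] at hi
    have htail : ∑ j ∈ Finset.Ioc y x, v j ≤ (x - y : ℝ) * p := by
      have := Finset.sum_le_card_nsmul (Finset.Ioc y x) v p fun j hj => by
        rw [Finset.mem_Ioc] at hj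
        exact (hv i j hi.1 (by omega) hj.2).trans hip.le
      simpa [Nat.cast_sub hyx] using this
    have hsplit : ∑ j ∈ Finset.Icc 1 x, v j
        = ∑ j ∈ Finset.Icc 1 y, v j + ∑ j ∈ Finset.Ioc y x, v j := by
      have := Finset.sum_Ioc_consecutive v (Nat.zero_le y) hyx
      exact this.symm
    linarith

/-- Lemma `lem:monotone`, monotonicity of feasible bids: if `b` and `b'`
are non-increasing positive bid vectors of the same length `k ≤ M` with `b' ≤ b`
pointwise, and `b` satisfies the RoI constraint against `β`, then so does `b'`, and
`V(b';β) ≤ V(b;β)`. -/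
theorem monotone_feasible
    (K M : ℕ) (v : ℕ → ℝ) (hv : ValidValuation M v) (hMK : M ≤ K)
    (b b' : BidVec) (hb : b.Valid) (hb' : b'.Valid)
    (hn : b'.n = b.n) (hnM : b.n ≤ M)
    (hle : ∀ j : ℕ, 1 ≤ j → j ≤ b.n → b'.bid j ≤ b.bid j)
    (β : Profile K) (hfeas : Feasible v K b β) :
    Feasible v K b' β ∧ value v K b' β ≤ value v K b β := by
  have hx := alloc_le K b β
  have hyx := alloc_mono hn hle β
  refine ⟨?_, ?_⟩
  · by_cases h : alloc K b' β = 0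
    · simp [Feasible, payment, value, h]
    · have hprice := mul_le_mul_of_nonneg_right (price_mono hn hle β h)
        (Nat.cast_nonneg (α := ℝ) (alloc K b' β))
      exact hprice.trans (mul_le_sum_of_mul_le_sum
        (fun i j hi hij hj => hv.2 i j hi hij (by omega)) hyx hfeas)
  · refine Finset.sum_le_sum_of_subset_of_nonneg (Finset.Icc_subset_Icc_right hyx)
      fun j hj _ => hv.1 j (Finset.mem_Icc.1 hj).1 ?_
    have := (Finset.mem_Icc.1 hj).2
    omega

end Auction
end

section
/- Value decomposition for safe undominated strategies: let b = ⟨(w_{Q_1},q_1),…,(w_{Q_m},q_m)⟩ be an m-uniform safe undominated strategy (so b_ℓ = w_{Q_ℓ} for all ℓ). Then for every competing-bid profile β₋, V(b;β₋) = max_{ℓ ∈ {1,…,m}} V((w_{Q_ℓ}, Q_ℓ); β₋), where (w_{Q_ℓ}, Q_ℓ) is the 1-uniform strategy bidding w_{Q_ℓ} on Q_ℓ units. -/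
open Finset

namespace Auction

theorem alloc_spec (K : ℕ) (b : BidVec) (β : Profile K) :
    alloc K b β ≤ min b.n K ∧ ∀ j ∈ Finset.Icc 1 (alloc K b β), β.c j ≤ b.bid j := by
  unfold alloc
  set S := @Finset.filter ℕ (fun r => ∀ j ∈ Finset.Icc 1 r, β.c j ≤ b.bid j)
    (fun _ => Classical.propDecidable _) (Finset.Icc 1 (min b.n K))
  rcases S.eq_empty_or_nonempty with h | h
  · simp [h]
  · obtain ⟨r, hr, hr'⟩ := Finset.exists_mem_eq_sup S h id
    rw [hr']
    obtain ⟨hr₁, hr₂⟩ := (@Finset.mem_filter _ _ (fun _ => Classical.propDecidable _) _ _).mp hr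
    exact ⟨(Finset.mem_Icc.mp hr₁).2, hr₂⟩

theorem le_alloc {K : ℕ} {b : BidVec} {β : Profile K} {r : ℕ} (hr : r ≤ min b.n K)
    (h : ∀ j ∈ Finset.Icc 1 r, β.c j ≤ b.bid j) : r ≤ alloc K b β := by
  rcases Nat.eq_zero_or_pos r with rfl | h0
  · exact Nat.zero_le _
  · exact Finset.le_sup (f := id)
      ((@Finset.mem_filter _ _ (fun _ => Classical.propDecidable _) _ _).mpr
        ⟨Finset.mem_Icc.mpr ⟨h0, hr⟩, h⟩)

theorem w_antitone_s5 {M : ℕ} {v : ℕ → ℝ} (hv : ValidValuation M v) {i j : ℕ} (hi : 1 ≤ i)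
    (hij : i ≤ j) (hj : j ≤ M) : w v j ≤ w v i := by
  induction j, hij using Nat.le_induction with
  | base => exact le_rfl
  | succ n hn ih =>
    refine le_trans ?_ (ih (by omega))
    have hn0 : (0 : ℝ) < n := by exact_mod_cast (by omega : 0 < n)
    have hsum : (n : ℝ) * v (n + 1) ≤ ∑ ℓ ∈ Finset.Icc 1 n, v ℓ := by
      have := Finset.card_nsmul_le_sum (Finset.Icc 1 n) v (v (n + 1)) fun x hx => by
        rw [Finset.mem_Icc] at hx
        exact hv.2 x (n + 1) hx.1 (by omega) hj
      simpa using this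
    unfold w
    rw [Finset.sum_Icc_succ_top (by omega), div_le_div_iff₀ (by positivity) hn0]
    push_cast
    nlinarith

/-- The least block index whose cumulative quantity reaches unit `j`. -/
theorem Uniform.sInf_spec (s : Uniform) {j ℓ : ℕ} (hj : 1 ≤ j) (h : j ≤ s.Q ℓ) :
    1 ≤ sInf {k : ℕ | j ≤ s.Q k} ∧ sInf {k : ℕ | j ≤ s.Q k} ≤ ℓ ∧
      j ≤ s.Q (sInf {k : ℕ | j ≤ s.Q k}) := by
  have hmem : j ≤ s.Q (sInf {k : ℕ | j ≤ s.Q k}) :=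
    Nat.sInf_mem (s := {k : ℕ | j ≤ s.Q k}) ⟨ℓ, h⟩
  refine ⟨?_, Nat.sInf_le h, hmem⟩
  by_contra! h0
  rw [Nat.lt_one_iff.mp h0] at hmem
  simp [Uniform.Q] at hmem
  omega

theorem value_le_value {M K : ℕ} {v : ℕ → ℝ} (hv : ValidValuation M v) {b b' : BidVec}
    {β : Profile K} (h : alloc K b β ≤ alloc K b' β) (hM : b'.n ≤ M) :
    value v K b β ≤ value v K b' β := by
  refine Finset.sum_le_sum_of_subset_of_nonneg (Finset.Icc_subset_Icc_right h) fun i hi _ => ?_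
  rw [Finset.mem_Icc] at hi
  have := (alloc_spec K b' β).1
  exact hv.1 i hi.1 (by omega)

theorem single_toBidVec_n (x : ℝ) (q : ℕ) : (single x q).toBidVec.n = q := by
  simp [Uniform.toBidVec, single, Uniform.Q]

theorem single_toBidVec_bid (x : ℝ) (q j : ℕ) : (single x q).toBidVec.bid j = x := rfl

/-- Lemma `lem:sum-to-max-equivalence-UF`: for an `m`-uniform safe
undominated strategy `b = ⟨(w (Q 1), q 1),…,(w (Q m), q m)⟩` and every competing-bid
profile `β`, `V(b;β) = max_{ℓ ∈ {1,…,m}} V((w (Q ℓ), Q ℓ); β)`. -/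
theorem value_decomposition_safe
    (K M : ℕ) (v : ℕ → ℝ) (hv : ValidValuation M v) (hMK : M ≤ K)
    (s : Uniform) (hm : 1 ≤ s.m)
    (hq : ∀ j : ℕ, 1 ≤ j → j ≤ s.m → 0 < s.q j) (hQM : s.Q s.m ≤ M)
    (hb : ∀ ℓ : ℕ, 1 ≤ ℓ → ℓ ≤ s.m → s.b ℓ = w v (s.Q ℓ))
    (β : Profile K) :
    value v K s.toBidVec β =
      (Finset.Icc 1 s.m).sup' (Finset.nonempty_Icc.mpr hm)
        (fun ℓ => value v K (single (w v (s.Q ℓ)) (s.Q ℓ)).toBidVec β) := by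
  have hn : s.toBidVec.n = s.Q s.m := rfl
  have hbid (j : ℕ) : s.toBidVec.bid j = s.b (sInf {k : ℕ | j ≤ s.Q k}) := rfl
  have hQ {ℓ : ℕ} (h : ℓ ≤ s.m) : s.Q ℓ ≤ s.Q s.m := s.Q_mono h
  obtain ⟨hr, hc⟩ := alloc_spec K s.toBidVec β
  apply le_antisymm
  · suffices h : ∃ ℓ ∈ Finset.Icc 1 s.m, alloc K s.toBidVec β ≤
        alloc K (single (w v (s.Q ℓ)) (s.Q ℓ)).toBidVec β by
      obtain ⟨ℓ, hℓ, h⟩ := h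
      refine le_trans (value_le_value hv h ?_) (Finset.le_sup' (fun ℓ =>
        value v K (single (w v (s.Q ℓ)) (s.Q ℓ)).toBidVec β) hℓ)
      rw [single_toBidVec_n]
      exact (hQ (Finset.mem_Icc.mp hℓ).2).trans hQM
    rcases Nat.eq_zero_or_pos (alloc K s.toBidVec β) with h0 | h0
    · exact ⟨1, by simp [hm], by simp [h0]⟩
    · obtain ⟨h1, h2, h3⟩ := s.sInf_spec (ℓ := s.m) h0 (by omega)
      have hlast := hc _ (Finset.mem_Icc.mpr ⟨h0, le_rfl⟩)
      rw [hbid, hb _ h1 h2] at hlast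
      refine ⟨_, Finset.mem_Icc.mpr ⟨h1, h2⟩, le_alloc ?_ fun j hj => ?_⟩
      · rw [single_toBidVec_n]
        omega
      · rw [Finset.mem_Icc] at hj
        rw [single_toBidVec_bid]
        exact (β.mono j _ hj.1 hj.2 (by omega)).trans hlast
  · refine Finset.sup'_le _ _ fun ℓ hℓ => value_le_value hv ?_ (hn ▸ hQM)
    obtain ⟨hℓ1, hℓm⟩ := Finset.mem_Icc.mp hℓ
    have hQℓ := hQ hℓm
    obtain ⟨hr', hc'⟩ := alloc_spec K (single (w v (s.Q ℓ)) (s.Q ℓ)).toBidVec β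
    rw [single_toBidVec_n] at hr'
    refine le_alloc (by omega) fun j hj => (hc' j hj).trans ?_
    rw [Finset.mem_Icc] at hj
    obtain ⟨h1, h2, h3⟩ := s.sInf_spec (ℓ := ℓ) hj.1 (by omega)
    rw [single_toBidVec_bid, hbid, hb _ h1 (by omega)]
    exact w_antitone_s5 hv (by omega) (s.Q_mono h2) (by omega)

end Auction
end
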